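/- Normal defaults cannot introduce inconsistency: if Δ is a set of normal defaults, then for every set Φ of formulas, Φ |≈_Δ ⊥ if and only if Φ ⊢ ⊥. -/

import Mathlib

namespace CPL

/-- Formulas of classical propositional logic over countably many variables,
with ¬ and ∨ as primitive connectives. -/
inductive Fml : Type where
  | var : ℕ → Fml
  | neg : Fml → Fml
  | or : Fml → Fml → Fml

/-- Material implication, defined from ¬ and ∨. -/
def fImp (p q : Fml) : Fml := .or (.neg p) q
/-- Falsum. -/
def fBot : Fml := .neg (.or (.var 0) (.neg (.var 0)))

/-- A complete classical set of axioms for ¬ and ∨ (Principia Mathematica style). -/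
inductive Ax : Fml → Prop where
  | pl1 (p : Fml) : Ax (fImp (.or p p) p)
  | pl2 (p q : Fml) : Ax (fImp p (.or p q))
  | pl3 (p q : Fml) : Ax (fImp (.or p q) (.or q p))
  | pl4 (p q r : Fml) : Ax (fImp (fImp p q) (fImp (.or r p) (.or r q)))

/-- Provability Φ ⊢ φ in classical propositional logic (axioms, hypotheses,
modus ponens). -/
inductive Prov (Φ : Set Fml) : Fml → Prop where
  | ax {p : Fml} : Ax p → Prov Φ p
  | hyp {p : Fml} : p ∈ Φ → Prov Φ p
  | mp {p q : Fml} : Prov Φ (fImp p q) → Prov Φ p → Prov Φ q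

/-- Deductive closure Cn(Ψ) = {φ : Ψ ⊢ φ}. -/
def Cn (Ψ : Set Fml) : Set Fml := {φ | Prov Ψ φ}

/-- A default π:ρ/χ with prerequisite, justification, and consequent. -/
structure Default : Type where
  pre : Fml
  jus : Fml
  con : Fml

/-- A default is normal iff its justification equals its consequent. -/
def Default.Normal (d : Default) : Prop := d.jus = d.con

/-- The operator Γ^Φ_Δ : `GammaSet Φ Δ Ψ` is the smallest set `X` of formulas such
that (i) Φ ⊆ X, (ii) X is deductively closed, and (iii) for each default π:ρ/χ in Δ,
if π ∈ X and ¬ρ ∉ Ψ then χ ∈ X. -/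
def GammaSet (Φ : Set Fml) (Δ : Set Default) (Ψ : Set Fml) : Set Fml :=
  ⋂₀ {X | Φ ⊆ X ∧ X = Cn X ∧ ∀ d ∈ Δ, d.pre ∈ X → Fml.neg d.jus ∉ Ψ → d.con ∈ X}

/-- `E` is a Reiter extension of Φ under Δ iff it is a fixed point of Γ^Φ_Δ. -/
def IsExtension (Φ : Set Fml) (Δ : Set Default) (E : Set Fml) : Prop :=
  E = GammaSet Φ Δ E

/-- Default consequence (Φ |≈_Δ φ): some Reiter extension E of Φ under Δ
satisfies E ⊢ φ. -/
def DCons (Φ : Set Fml) (Δ : Set Default) (φ : Fml) : Prop :=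
  ∃ E, IsExtension Φ Δ E ∧ Prov E φ

/-- |≈_Δ interprets ⊢ iff whenever Φ ⊢ φ, also Φ |≈_Δ φ. -/
def Interprets (Δ : Set Default) : Prop :=
  ∀ (Φ : Set Fml) (φ : Fml), Prov Φ φ → DCons Φ Δ φ

end CPL

namespace CPL

theorem Prov.mono {Φ Ψ : Set Fml} (h : Φ ⊆ Ψ) {φ : Fml} (hφ : Prov Φ φ) : Prov Ψ φ := by
  induction hφ with
  | ax hp => exact .ax hp
  | hyp hp => exact .hyp (h hp)
  | mp _ _ ihpq ihp => exact .mp ihpq ihp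

theorem Prov.cut {Φ : Set Fml} {φ : Fml} (hφ : Prov (Cn Φ) φ) : Prov Φ φ := by
  induction hφ with
  | ax hp => exact .ax hp
  | hyp hp => exact hp
  | mp _ _ ihpq ihp => exact .mp ihpq ihp

theorem cn_cn (Φ : Set Fml) : Cn Φ = Cn (Cn Φ) :=
  Set.Subset.antisymm (fun _ h => Prov.hyp h) (fun _ h => Prov.cut h)

theorem Prov.imp_self (Φ : Set Fml) (p : Fml) : Prov Φ (fImp p p) :=
  .mp (.mp (.ax (.pl4 (.or p p) p (.neg p))) (.ax (.pl1 p))) (.ax (.pl2 p p))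

theorem Prov.excluded_middle (Φ : Set Fml) (p : Fml) : Prov Φ (.or p (.neg p)) :=
  .mp (.ax (.pl3 (.neg p) p)) (Prov.imp_self Φ p)

theorem Prov.explosion {Φ : Set Fml} (h : Prov Φ fBot) (φ : Fml) : Prov Φ φ :=
  .mp (.mp (.ax (.pl2 _ φ)) h) (Prov.excluded_middle Φ (.var 0))

theorem mem_gammaSet_of_prov {Φ : Set Fml} {Δ : Set Default} {Ψ : Set Fml} {φ : Fml}
    (h : Prov (GammaSet Φ Δ Ψ) φ) : φ ∈ GammaSet Φ Δ Ψ := by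
  intro X hX
  rw [hX.2.1]
  exact h.mono (Set.sInter_subset_of_mem hX)

theorem subset_gammaSet (Φ : Set Fml) (Δ : Set Default) (Ψ : Set Fml) :
    Φ ⊆ GammaSet Φ Δ Ψ :=
  Set.subset_sInter fun _ hX => hX.1

theorem gammaSet_univ_subset_cn (Φ : Set Fml) (Δ : Set Default) :
    GammaSet Φ Δ Set.univ ⊆ Cn Φ :=
  Set.sInter_subset_of_mem
    ⟨fun _ h => Prov.hyp h, cn_cn Φ, fun _ _ _ h => absurd (Set.mem_univ _) h⟩

end CPL

/-- Normal defaults cannot introduce inconsistency: if Δ is a set of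
normal defaults, then for every Φ, Φ |≈_Δ ⊥ iff Φ ⊢ ⊥. -/
theorem CPL.normal_defaults_preserve_consistency
    (Δ : Set CPL.Default) (hΔ : ∀ d ∈ Δ, d.Normal) (Φ : Set CPL.Fml) :
    CPL.DCons Φ Δ CPL.fBot ↔ CPL.Prov Φ CPL.fBot := by
  constructor
  · rintro ⟨E, hE, hbot⟩
    have hE' : E = GammaSet Φ Δ E := hE
    have huniv : E = Set.univ := Set.eq_univ_of_forall fun φ => by
      have h := hbot.explosion φ
      rw [hE'] at h ⊢
      exact mem_gammaSet_of_prov h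
    subst huniv
    exact gammaSet_univ_subset_cn Φ Δ (hE' ▸ Set.mem_univ fBot)
  · intro hbot
    refine ⟨Set.univ, (Set.eq_univ_of_forall fun φ => ?_).symm, .hyp (Set.mem_univ _)⟩
    exact mem_gammaSet_of_prov ((hbot.explosion φ).mono (subset_gammaSet Φ Δ _))
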